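/- Let G be a finite group, J a p-perfect subgroup, working in the Burnside algebra over a ring R where all primes dividing |G| except p are invertible. Then Ind_H^G([H/J] · f_J^H) = [G/J] · f_J^G for any H with J ≤ H ≤ G, where f_J denotes the primitive idempotent of the Burnside algebra indexed by the p-perfect subgroup J. -/

import Mathlib

open Pointwise

attribute [local instance] Classical.propDecidable

/-- `O^p(G)`: the smallest normal subgroup with quotient a `p`-group. -/
def pResidual (p : ℕ) (G : Type*) [Group G] : Subgroup G :=
  sInf {N : Subgroup G | N.Normal ∧ ∀ g : G, ∃ n : ℕ, g ^ p ^ n ∈ N}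

/-- `O^p(L)` for a subgroup `L ≤ G`, viewed as a subgroup of `G`. -/
def pResidualSub (p : ℕ) {G : Type*} [Group G] (L : Subgroup G) : Subgroup G :=
  (pResidual p L).map L.subtype

section PPerfect

variable {p : ℕ} {K L : Type*} [Group K] [Group L]

theorem pResidual_eq_top_iff :
    pResidual p K = ⊤ ↔
      ∀ N : Subgroup K, N.Normal → (∀ g : K, ∃ n : ℕ, g ^ p ^ n ∈ N) → N = ⊤ := by
  simp [pResidual, sInf_eq_top]

theorem pResidual_eq_top_of_surjective (f : K →* L) (hf : Function.Surjective f)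
    (h : pResidual p K = ⊤) : pResidual p L = ⊤ := by
  rw [pResidual_eq_top_iff] at h ⊢
  intro N hN hpow
  have hcomap : N.comap f = ⊤ := by
    refine h _ (hN.comap f) fun g => ?_
    obtain ⟨n, hn⟩ := hpow (f g)
    exact ⟨n, by simpa using hn⟩
  rw [eq_top_iff]
  intro y _
  obtain ⟨x, rfl⟩ := hf y
  have hx : x ∈ N.comap f := hcomap ▸ Subgroup.mem_top x
  exact hx

theorem pResidualSub_le (V : Subgroup K) : pResidualSub p V ≤ V :=
  Subgroup.map_subtype_le _

theorem pResidualSub_eq_self_iff (V : Subgroup K) :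
    pResidualSub p V = V ↔ pResidual p V = ⊤ := by
  refine ⟨fun h => ?_, fun h => ?_⟩
  · rw [eq_top_iff]
    intro x _
    have hx : (x : K) ∈ pResidualSub p V := h.ge x.2
    obtain ⟨y, hy, hyx⟩ := hx
    exact Subtype.ext hyx ▸ hy
  · rw [pResidualSub, h, ← MonoidHom.range_eq_map, Subgroup.range_subtype]

end PPerfect

section Marks

variable {K : Type*} [Group K]

/-- The fixed points of a subgroup `V` of `K` on a `K`-set `X`. -/
abbrev subgroupFixedPoints (X : Type*) [MulAction K X] (V : Subgroup K) : Set X :=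
  MulAction.fixedPoints V X

theorem mk_mem_fixedPoints_iff {V W : Subgroup K} {x : K} :
    (x : K ⧸ W) ∈ subgroupFixedPoints (K ⧸ W) V ↔ ∀ v ∈ V, x⁻¹ * v * x ∈ W := by
  refine ⟨fun h v hv => ?_, fun h v => ?_⟩
  · have := h ⟨v, hv⟩
    rw [Subgroup.smul_def, MulAction.Quotient.smul_coe, smul_eq_mul, eq_comm,
      QuotientGroup.eq] at this
    simpa [mul_assoc] using this
  · rw [Subgroup.smul_def, MulAction.Quotient.smul_coe, smul_eq_mul, eq_comm, QuotientGroup.eq]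
    simpa [mul_assoc] using h v v.2

/-- The mark of a `K`-set `X` at a subgroup `V`. -/
noncomputable def mark (X : Type*) [MulAction K X] (V : Subgroup K) : ℕ :=
  Nat.card (subgroupFixedPoints X V)

theorem mark_ne_zero_iff [Finite K] {V W : Subgroup K} :
    mark (K ⧸ W) V ≠ 0 ↔ ∃ x : K, ∀ v ∈ V, x⁻¹ * v * x ∈ W := by
  rw [mark, Nat.card_ne_zero]
  refine ⟨?_, ?_⟩
  · rintro ⟨⟨q, hq⟩, -⟩
    induction q using QuotientGroup.induction_on with
    | H x => exact ⟨x, mk_mem_fixedPoints_iff.1 hq⟩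
  · rintro ⟨x, hx⟩
    exact ⟨⟨⟨x, mk_mem_fixedPoints_iff.2 hx⟩⟩, inferInstance⟩

theorem mark_self_eq_card [Finite K] (V : Subgroup K) :
    mark (K ⧸ V) V = Nat.card (Subgroup.normalizer (V : Set K) ⧸
      V.subgroupOf (Subgroup.normalizer (V : Set K))) :=
  Nat.card_congr (Sylow.fixedPointsMulLeftCosetsEquivQuotient V)

theorem mark_self_dvd_card [Finite K] (V : Subgroup K) : mark (K ⧸ V) V ∣ Nat.card K := by
  rw [mark_self_eq_card]
  exact (Subgroup.card_quotient_dvd_card _).trans (Subgroup.card_subgroup_dvd_card _)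

theorem mark_self_ne_zero [Finite K] (V : Subgroup K) : mark (K ⧸ V) V ≠ 0 :=
  mark_ne_zero_iff.2 ⟨1, by simp⟩

theorem exists_mem_normalizer_pow_mem [Finite K] {p : ℕ} [Fact p.Prime] {V : Subgroup K}
    (h : p ∣ mark (K ⧸ V) V) :
    ∃ g ∈ Subgroup.normalizer (V : Set K), g ∉ V ∧ g ^ p ∈ V := by
  rw [mark_self_eq_card] at h
  have : (V.subgroupOf (Subgroup.normalizer (V : Set K))).Normal := Subgroup.normal_in_normalizer
  obtain ⟨q, hq⟩ := exists_prime_orderOf_dvd_card' p h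
  induction q using QuotientGroup.induction_on with
  | H g =>
    refine ⟨g, g.2, fun hg => ?_, ?_⟩
    · have : (g : _ ⧸ V.subgroupOf (Subgroup.normalizer (V : Set K))) = 1 :=
        (QuotientGroup.eq_one_iff g).2 hg
      erw [this, orderOf_one] at hq
      exact (Fact.out : p.Prime).one_lt.ne hq
    · have h1 := pow_orderOf_eq_one (g : _ ⧸ V.subgroupOf (Subgroup.normalizer (V : Set K)))
      erw [hq, ← QuotientGroup.mk_pow, QuotientGroup.eq_one_iff] at h1
      exact h1

/-- If `g` normalizes `V` and `g ^ p ∈ V`, the subgroup `V⟨g⟩` consists of elements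
`g ^ k * v`, normalizes `V`, and all its `p`-th powers lie in `V`. -/
theorem exists_cyclic_extension {p : ℕ} {V : Subgroup K} {g : K}
    (hg : g ∈ Subgroup.normalizer (V : Set K)) (hgp : g ^ p ∈ V) :
    ∃ V' : Subgroup K, V ≤ V' ∧ g ∈ V' ∧ V' ≤ Subgroup.normalizer (V : Set K) ∧
      (∀ y ∈ V', y ^ p ∈ V) ∧ ∀ y ∈ V', ∃ k : ℤ, ∃ v ∈ V, y = g ^ k * v := by
  have : (V.subgroupOf (Subgroup.normalizer (V : Set K))).Normal := Subgroup.normal_in_normalizer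
  set N := Subgroup.normalizer (V : Set K)
  have key : ∀ y : N, (y : N ⧸ V.subgroupOf N) ∈ Subgroup.zpowers
      ((⟨g, hg⟩ : N) : N ⧸ V.subgroupOf N) → ∃ k : ℤ, ∃ v ∈ V, (y : K) = g ^ k * v := by
    rintro y ⟨k, hk⟩
    refine ⟨k, (g ^ k)⁻¹ * y, ?_, by group⟩
    simp only at hk
    rw [← QuotientGroup.mk_zpow, QuotientGroup.eq, Subgroup.mem_subgroupOf] at hk
    simpa using hk
  refine ⟨((Subgroup.zpowers ((⟨g, hg⟩ : N) : N ⧸ V.subgroupOf N)).comap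
    (QuotientGroup.mk' (V.subgroupOf N))).map N.subtype, ?_, ?_, ?_, ?_, ?_⟩
  · intro v hv
    have hvN : v ∈ N := Subgroup.le_normalizer hv
    refine ⟨⟨v, hvN⟩, ?_, rfl⟩
    have : ((⟨v, hvN⟩ : N) : N ⧸ V.subgroupOf N) = 1 := (QuotientGroup.eq_one_iff _).2 hv
    simp [this]
  · exact ⟨⟨g, hg⟩, Subgroup.mem_zpowers _, rfl⟩
  · exact Subgroup.map_subtype_le _
  · rintro _ ⟨y, ⟨k, hk⟩, rfl⟩
    have h1 : ((⟨g, hg⟩ : N) : N ⧸ V.subgroupOf N) ^ p = 1 := by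
      rw [← QuotientGroup.mk_pow, QuotientGroup.eq_one_iff]
      exact hgp
    have h2 : (y : N ⧸ V.subgroupOf N) ^ p = 1 := by
      have hk' : (((⟨g, hg⟩ : N) : N ⧸ V.subgroupOf N)) ^ k = (y : N ⧸ V.subgroupOf N) := hk
      rw [← hk', ← zpow_natCast, ← zpow_mul, mul_comm, zpow_mul, zpow_natCast, h1, one_zpow]
    rw [← QuotientGroup.mk_pow, QuotientGroup.eq_one_iff] at h2
    exact h2
  · rintro _ ⟨y, hy, rfl⟩
    exact key y hy

theorem mark_modEq_of_cyclic_extension {X : Type*} [MulAction K X] [Finite X]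
    {p : ℕ} [Fact p.Prime] {V V' : Subgroup K} {g : K} (hle : V ≤ V') (hgV' : g ∈ V')
    (hg : g ∈ Subgroup.normalizer (V : Set K)) (hgp : g ^ p ∈ V)
    (hV' : ∀ y ∈ V', ∃ k : ℤ, ∃ v ∈ V, y = g ^ k * v) :
    mark X V ≡ mark X V' [MOD p] := by
  have hmaps : ∀ x ∈ subgroupFixedPoints X V, g • x ∈ subgroupFixedPoints X V := by
    intro x hx v
    have hv : g⁻¹ * v * g ∈ V := by
      have := (Subgroup.mem_normalizer_iff''.1 hg v).1 v.2
      simpa using this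
    have := hx ⟨_, hv⟩
    rw [Subgroup.smul_def] at this ⊢
    rw [← mul_smul]
    conv_rhs => rw [← this, ← mul_smul]
    simp [mul_assoc]
  let f : Function.End (subgroupFixedPoints X V) := fun x => ⟨g • x.1, hmaps x.1 x.2⟩
  have hfpow : ∀ n : ℕ, ∀ x, (((f ^ n : Function.End _) x : subgroupFixedPoints X V) : X) =
      g ^ n • (x : X) := by
    intro n
    induction n with
    | zero => intro x; rw [pow_zero, pow_zero, one_smul]; rfl
    | succ n ih =>
      intro x
      rw [pow_succ, pow_succ, mul_smul]
      exact ih (f x)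
  have hf : f ^ p ^ 1 = 1 := by
    funext x
    apply Subtype.ext
    rw [pow_one, hfpow]
    exact x.2 ⟨_, hgp⟩
  let := Fintype.ofFinite (subgroupFixedPoints X V)
  have h := Equiv.Perm.card_fixedPoints_modEq hf
  rw [← Nat.card_eq_fintype_card, ← Nat.card_eq_fintype_card] at h
  suffices hcard : Nat.card (Function.fixedPoints f) = mark X V' from hcard ▸ h
  refine Nat.card_congr ⟨fun x => ⟨x.1.1, ?_⟩, fun x => ⟨⟨x.1, ?_⟩, ?_⟩, fun _ => rfl, fun _ => rfl⟩
  · rintro ⟨y, hy⟩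
    obtain ⟨k, v, hv, rfl⟩ := hV' y hy
    have h1 : g • x.1.1 = x.1.1 := congrArg Subtype.val x.2
    have h2 : v • x.1.1 = x.1.1 := x.1.2 ⟨v, hv⟩
    have h3 : g ^ k ∈ MulAction.stabilizer K x.1.1 :=
      Subgroup.zpow_mem _ (MulAction.mem_stabilizer_iff.2 h1) k
    rw [Subgroup.smul_def, mul_smul, h2]
    exact h3
  · exact fun v => x.2 ⟨v, hle v.2⟩
  · exact Subtype.ext (x.2 ⟨g, hgV'⟩)

theorem mark_eq_zero_of_cyclic_extension [Finite K] {p : ℕ} {L V V' : Subgroup K}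
    (hL : pResidual p L = ⊤) (hLV : mark (K ⧸ V) L = 0)
    (hnorm : V' ≤ Subgroup.normalizer (V : Set K)) (hpow : ∀ y ∈ V', y ^ p ∈ V) :
    mark (K ⧸ V') L = 0 := by
  by_contra hne
  obtain ⟨x, hx⟩ := mark_ne_zero_iff.1 hne
  refine mark_ne_zero_iff.2 ⟨x, ?_⟩ hLV
  have htop : (V.comap (MulAut.conj x⁻¹).toMonoidHom).subgroupOf L = ⊤ := by
    refine pResidual_eq_top_iff.1 hL _ ⟨fun n hn l => ?_⟩ fun l => ⟨1, ?_⟩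
    · have h1 := hnorm (hx l l.2)
      have h2 : x⁻¹ * n * x ∈ V := by simpa [Subgroup.mem_subgroupOf] using hn
      have h3 := (Subgroup.mem_normalizer_iff.1 h1 _).1 h2
      simpa [Subgroup.mem_subgroupOf, mul_assoc] using h3
    · have h1 := hpow _ (hx l l.2)
      have h2 : (x⁻¹ * (l : K) * x) ^ p = x⁻¹ * (l : K) ^ p * x := by
        simpa using conj_pow (i := p) (a := x⁻¹) (b := (l : K))
      rw [h2] at h1
      simpa [Subgroup.mem_subgroupOf] using h1
  intro v hv
  have hv' : (⟨v, hv⟩ : L) ∈ (V.comap (MulAut.conj x⁻¹).toMonoidHom).subgroupOf L :=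
    htop ▸ Subgroup.mem_top _
  simpa [Subgroup.mem_subgroupOf] using hv'

theorem exists_mark_eq_zero_and_not_dvd [Finite K] {p : ℕ} [Fact p.Prime] {L : Subgroup K}
    (hL : pResidual p L = ⊤) (V : Subgroup K) (hLV : mark (K ⧸ V) L = 0) :
    ∃ W : Subgroup K, mark (K ⧸ W) L = 0 ∧ ¬ p ∣ mark (K ⧸ W) V := by
  induction V using WellFoundedGT.induction with
  | ind V ih =>
    by_cases hdvd : p ∣ mark (K ⧸ V) V
    · obtain ⟨g, hgN, hgV, hgp⟩ := exists_mem_normalizer_pow_mem hdvd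
      obtain ⟨V', hle, hgV', hnorm, hpow, hV'⟩ := exists_cyclic_extension hgN hgp
      obtain ⟨W, hW, hnd⟩ := ih V' (lt_of_le_of_ne hle fun h => hgV (h ▸ hgV'))
        (mark_eq_zero_of_cyclic_extension hL hLV hnorm hpow)
      refine ⟨W, hW, fun h => hnd ?_⟩
      exact ((mark_modEq_of_cyclic_extension hle hgV' hgN hgp hV').dvd_iff dvd_rfl).1 h
    · exact ⟨V, hLV, hdvd⟩

end Marks

section Span

variable (R : Type*) [CommRing R] (K : Type*) [Group K]

/-- The span of the mark functions of transitive `K`-sets. -/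
def markSpan : Submodule R (Subgroup K → R) :=
  Submodule.span R (Set.range fun (A V : Subgroup K) => (mark (K ⧸ A) V : R))

variable {K}

theorem mark_quotient_mem_markSpan (A : Subgroup K) :
    (fun V : Subgroup K => (mark (K ⧸ A) V : R)) ∈ markSpan R K :=
  Submodule.subset_span ⟨A, rfl⟩

theorem card_fixedPoints_orbit (X : Type*) [MulAction K X] (V : Subgroup K) (x : X) :
    Nat.card {y : subgroupFixedPoints X V // (y : X) ∈ MulAction.orbit K x} =
      mark (K ⧸ MulAction.stabilizer K x) V := by
  symm
  refine Nat.card_congr (Equiv.ofBijective (fun q =>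
    ⟨⟨MulAction.ofQuotientStabilizer K x q.1, fun v => ?_⟩, ?_⟩) ⟨?_, ?_⟩)
  · rw [Subgroup.smul_def, ← MulAction.ofQuotientStabilizer_smul]
    exact congrArg _ (q.2 v)
  · exact MulAction.ofQuotientStabilizer_mem_orbit K x q.1
  · intro q q' h
    exact Subtype.ext (MulAction.injective_ofQuotientStabilizer K x
      (congrArg (fun z => z.1.1) h))
  · rintro ⟨⟨y, hy⟩, g, hgy⟩
    obtain rfl : g • x = y := hgy
    refine ⟨⟨(g : K ⧸ MulAction.stabilizer K x), fun v => ?_⟩, rfl⟩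
    apply MulAction.injective_ofQuotientStabilizer K x
    rw [Subgroup.smul_def, MulAction.ofQuotientStabilizer_smul]
    exact hy v

theorem mark_mem_markSpan (X : Type*) [MulAction K X] [Finite X] :
    (fun V : Subgroup K => (mark X V : R)) ∈ markSpan R K := by
  let : Fintype (MulAction.orbitRel.Quotient K X) := Fintype.ofFinite _
  have h : (fun V : Subgroup K => (mark X V : R)) =
      ∑ ω : MulAction.orbitRel.Quotient K X,
        fun V : Subgroup K => (mark (K ⧸ MulAction.stabilizer K ω.out) V : R) := by
    funext V
    rw [Finset.sum_apply, ← Nat.cast_sum]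
    congr 1
    rw [mark, ← Nat.card_congr (Equiv.sigmaFiberEquiv fun y : subgroupFixedPoints X V =>
      (Quotient.mk'' (y : X) : MulAction.orbitRel.Quotient K X)), Nat.card_sigma]
    refine Finset.sum_congr rfl fun ω _ => ?_
    rw [← card_fixedPoints_orbit]
    refine Nat.card_congr (Equiv.subtypeEquivRight fun y => ?_)
    rw [← MulAction.orbitRel_apply, ← Quotient.eq'', Quotient.out_eq']
  rw [h]
  exact Submodule.sum_mem _ fun ω _ => mark_quotient_mem_markSpan R _

theorem mark_prod {X Y : Type*} [MulAction K X] [MulAction K Y] (V : Subgroup K) :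
    mark (X × Y) V = mark X V * mark Y V := by
  rw [mark, mark, mark, ← Nat.card_prod]
  refine Nat.card_congr ⟨fun z => (⟨z.1.1, fun v => congrArg Prod.fst (z.2 v)⟩,
    ⟨z.1.2, fun v => congrArg Prod.snd (z.2 v)⟩),
    fun z => ⟨(z.1.1, z.2.1), fun v => Prod.ext (z.1.2 v) (z.2.2 v)⟩, fun _ => rfl, fun _ => rfl⟩

variable (K) in
/-- The Burnside algebra of `K`, as an algebra of mark functions. -/
def markAlgebra [Finite K] : Subalgebra R (Subgroup K → R) :=
  (markSpan R K).toSubalgebra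
    (by
      have h := mark_mem_markSpan R (K := K) (K ⧸ (⊤ : Subgroup K))
      convert h using 1
      funext V
      have : Subsingleton (K ⧸ (⊤ : Subgroup K)) := QuotientGroup.subsingleton_quotient_top
      have huniv : subgroupFixedPoints (K ⧸ (⊤ : Subgroup K)) V = Set.univ :=
        Set.eq_univ_of_forall fun q v => Subsingleton.elim _ _
      rw [mark, huniv, Nat.card_univ, Nat.card_unique, Nat.cast_one, Pi.one_apply])
    (by
      have h : markSpan R K * markSpan R K ≤ markSpan R K := by
        rw [markSpan, Submodule.span_mul_span, Submodule.span_le]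
        rintro _ ⟨_, ⟨A, rfl⟩, _, ⟨B, rfl⟩, rfl⟩
        have := mark_mem_markSpan R (K := K) ((K ⧸ A) × (K ⧸ B))
        simp only [mark_prod, Nat.cast_mul] at this
        exact this
      exact fun x y hx hy => h (Submodule.mul_mem_mul hx hy))

theorem mark_conj_smul (X : Type*) [MulAction K X] (x : K) (V : Subgroup K) :
    mark X (MulAut.conj x • V) = mark X V := by
  refine Nat.card_congr ((MulAction.toPerm x⁻¹ : Equiv.Perm X).subtypeEquiv fun y => ?_)
  refine ⟨fun h v => ?_, fun h => ?_⟩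
  · have := h ⟨_, Subgroup.smul_mem_pointwise_smul v.1 (MulAut.conj x) V v.2⟩
    rw [Subgroup.smul_def] at this ⊢
    simp only [MulAut.smul_def, MulAut.conj_apply, mul_smul] at this
    rw [MulAction.toPerm_apply, eq_inv_smul_iff]
    exact this
  · rintro ⟨_, v, hv, rfl⟩
    have := h ⟨v, hv⟩
    rw [Subgroup.smul_def, MulAction.toPerm_apply, eq_inv_smul_iff] at this
    rw [Subgroup.smul_def]
    simpa [mul_smul] using this

variable {R}

theorem apply_conj_smul_of_mem_markSpan {f : Subgroup K → R} (hf : f ∈ markSpan R K) (x : K)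
    (V : Subgroup K) : f (MulAut.conj x • V) = f V := by
  induction hf using Submodule.span_induction with
  | mem f hf =>
    obtain ⟨A, rfl⟩ := hf
    simp [mark_conj_smul]
  | zero => rfl
  | add f g _ _ hf hg => simp [hf, hg]
  | smul a f _ hf => simp [hf]

theorem isUnit_natCast_of_dvd {n p : ℕ} (hn : n ≠ 0)
    (hinv : ∀ q : ℕ, q.Prime → q ∣ n → q ≠ p → IsUnit (q : R)) {d : ℕ} (hd : d ∣ n)
    (hpd : ¬ p ∣ d) : IsUnit (d : R) := by
  induction d using induction_on_primes with
  | zero => exact absurd (zero_dvd_iff.1 hd) hn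
  | one => simp
  | prime_mul q a hq ih =>
    rw [Nat.cast_mul]
    refine (hinv q hq (dvd_of_mul_right_dvd hd) ?_).mul
      (ih (dvd_of_mul_left_dvd hd) fun h => hpd (h.mul_left q))
    rintro rfl
    exact hpd (dvd_mul_right q a)

theorem card_conj_smul (x : K) (V : Subgroup K) :
    Nat.card (MulAut.conj x • V : Subgroup K) = Nat.card V :=
  Nat.card_congr (Subgroup.equivSMul (MulAut.conj x) V).symm.toEquiv

variable [Finite K] {p : ℕ}

theorem exists_mem_markAlgebra_separating [Fact p.Prime]
    (hinv : ∀ q : ℕ, q.Prime → q ∣ Nat.card K → q ≠ p → IsUnit (q : R))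
    {L : Subgroup K} (hL : pResidual p L = ⊤) {V : Subgroup K} (hLV : mark (K ⧸ V) L = 0) :
    ∃ f ∈ markAlgebra R K, f L = 1 ∧ f V = 0 := by
  obtain ⟨W, hW, hWV⟩ := exists_mark_eq_zero_and_not_dvd hL V hLV
  set m := mark (K ⧸ W) V
  set k := mark (K ⧸ V) V
  have hu : IsUnit ((m.gcd k : ℕ) : R) :=
    isUnit_natCast_of_dvd Nat.card_pos.ne' hinv
      ((Nat.gcd_dvd_right m k).trans (mark_self_dvd_card V))
      fun h => hWV (h.trans (Nat.gcd_dvd_left m k))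
  obtain ⟨c, hc⟩ := hu.exists_right_inv
  have hgcd : ((m.gcd k : ℕ) : R) = m * (m.gcdA k : R) + k * (m.gcdB k : R) := by
    have := congrArg (Int.cast : ℤ → R) (Nat.gcd_eq_gcd_ab m k)
    push_cast at this
    exact this
  refine ⟨1 - ((c * (m.gcdA k : R)) • (fun U : Subgroup K => (mark (K ⧸ W) U : R)) +
    (c * (m.gcdB k : R)) • fun U : Subgroup K => (mark (K ⧸ V) U : R)), ?_, ?_, ?_⟩
  · refine sub_mem (one_mem _) (add_mem ?_ ?_) <;>
      exact Subalgebra.smul_mem _ (mark_quotient_mem_markSpan R _) _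
  · simp [hW, hLV]
  · rw [hgcd] at hc
    simp only [Pi.sub_apply, Pi.one_apply, Pi.add_apply, Pi.smul_apply, smul_eq_mul]
    linear_combination -hc

theorem exists_conj_smul_le_of_mark_ne_zero {U L : Subgroup K} (h : mark (K ⧸ L) U ≠ 0) :
    ∃ x : K, MulAut.conj x • U ≤ L := by
  obtain ⟨x, hx⟩ := mark_ne_zero_iff.1 h
  refine ⟨x⁻¹, ?_⟩
  rintro _ ⟨u, hu, rfl⟩
  simpa using hx u hu

theorem mark_eq_zero_of_lt {V L : Subgroup K} (h : V < L) : mark (K ⧸ V) L = 0 := by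
  by_contra hne
  obtain ⟨x, hx⟩ := exists_conj_smul_le_of_mark_ne_zero hne
  have h1 := Subgroup.eq_of_le_of_card_ge h.le (by
    rw [← card_conj_smul x L]
    exact Subgroup.card_le_of_le hx)
  exact h.ne h1

theorem mark_mul_indicator_card_mem_markAlgebra [Fact p.Prime]
    (hinv : ∀ q : ℕ, q.Prime → q ∣ Nat.card K → q ≠ p → IsUnit (q : R))
    {L : Subgroup K} (hL : pResidual p L = ⊤) :
    (fun U : Subgroup K => (mark (K ⧸ L) U : R) * if Nat.card U = Nat.card L then 1 else 0) ∈
      markAlgebra R K := by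
  choose! f hfmem hfL hfV using fun (V : Subgroup K) (hV : V < L) =>
    exists_mem_markAlgebra_separating hinv hL (mark_eq_zero_of_lt hV)
  let : Fintype (Subgroup K) := Fintype.ofFinite _
  have hprod : ∏ V with V < L, f V ∈ markAlgebra R K :=
    prod_mem fun V hV => hfmem V (by simpa using hV)
  have hmem := mul_mem (show _ ∈ markAlgebra R K from mark_quotient_mem_markSpan R L) hprod
  convert hmem using 1
  funext U
  simp only [Pi.mul_apply]
  by_cases hU : mark (K ⧸ L) U = 0
  · simp [hU]
  obtain ⟨x, hx⟩ := exists_conj_smul_le_of_mark_ne_zero hU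
  rw [← apply_conj_smul_of_mem_markSpan hprod x U, Finset.prod_apply]
  congr 1
  rcases hx.lt_or_eq with hlt | heq
  · have hne : Nat.card U ≠ Nat.card L := fun h =>
      hlt.ne (Subgroup.eq_of_le_of_card_ge hx (by rw [card_conj_smul, h]))
    rw [if_neg hne]
    symm
    exact Finset.prod_eq_zero (i := MulAut.conj x • U)
      (Finset.mem_filter.2 ⟨Finset.mem_univ _, hlt⟩) (hfV _ hlt)
  · rw [if_pos (by rw [← card_conj_smul x U, heq]), heq]
    exact (Finset.prod_eq_one fun V hV => hfL V (by simpa using hV)).symm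

theorem mark_mul_indicator_pResidualSub {L : Subgroup K} (hL : pResidual p L = ⊤)
    (U : Subgroup K) :
    ((mark (K ⧸ L) U : R) *
      if ∃ g : K, MulAut.conj g • pResidualSub p U = L then 1 else 0) =
    (mark (K ⧸ L) U : R) * if Nat.card U = Nat.card L then 1 else 0 := by
  by_cases hU : mark (K ⧸ L) U = 0
  · simp [hU]
  obtain ⟨x, hx⟩ := exists_conj_smul_le_of_mark_ne_zero hU
  congr 1
  refine if_congr ⟨?_, fun h => ⟨x, ?_⟩⟩ rfl rfl
  · rintro ⟨g, hg⟩
    apply le_antisymm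
    · rw [← card_conj_smul x U]
      exact Subgroup.card_le_of_le hx
    · rw [← hg, card_conj_smul]
      exact Subgroup.card_le_of_le (pResidualSub_le U)
  · have heq : MulAut.conj x • U = L :=
      Subgroup.eq_of_le_of_card_ge hx (by rw [card_conj_smul, h])
    subst heq
    let e := (Subgroup.equivSMul (MulAut.conj x) U).symm
    rw [(pResidualSub_eq_self_iff U).2
      (pResidual_eq_top_of_surjective e.toMonoidHom e.surjective hL)]

end Span

section Induction

variable {G : Type*} [Group G] {H A : Subgroup G}

/-- The map `H / A → G / A` for `A ≤ H ≤ G`. -/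
def quotientInclusion (H A : Subgroup G) : H ⧸ A.subgroupOf H → G ⧸ A :=
  Quotient.map' Subtype.val fun a b h => by
    rw [QuotientGroup.leftRel_apply] at h ⊢
    exact h

theorem card_fixedPoints_fiber (hAH : A ≤ H) (U : Subgroup G) (g : G)
    (hg : (g : G ⧸ H) ∈ subgroupFixedPoints (G ⧸ H) U) :
    Nat.card {y : subgroupFixedPoints (G ⧸ A) U //
        Subgroup.quotientMapOfLE hAH y = (g : G ⧸ H)} =
      mark (H ⧸ A.subgroupOf H) ((MulAut.conj g⁻¹ • U).subgroupOf H) := by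
  have hg' := mk_mem_fixedPoints_iff.1 hg
  symm
  have hmem : ∀ h : H, ((h : H ⧸ A.subgroupOf H) ∈ subgroupFixedPoints
      (H ⧸ A.subgroupOf H) ((MulAut.conj g⁻¹ • U).subgroupOf H)) ↔
      ((g * h : G) : G ⧸ A) ∈ subgroupFixedPoints (G ⧸ A) U := by
    intro h
    rw [mk_mem_fixedPoints_iff, mk_mem_fixedPoints_iff]
    refine ⟨fun hh u hu => ?_, fun hh v hv => ?_⟩
    · have := hh ⟨_, hg' u hu⟩ (Subgroup.mem_subgroupOf.2 ⟨u, hu, by simp⟩)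
      simpa [Subgroup.mem_subgroupOf, mul_assoc] using this
    · obtain ⟨u, hu, huv⟩ := Subgroup.mem_subgroupOf.1 hv
      have := hh u hu
      simp at huv
      rw [Subgroup.mem_subgroupOf]
      simp [← huv]
      simpa [mul_assoc] using this
  refine Nat.card_congr (Equiv.ofBijective (fun q =>
    ⟨⟨g • quotientInclusion H A q.1, ?_⟩, ?_⟩) ⟨?_, ?_⟩)
  · obtain ⟨q, hq⟩ := q
    induction q using QuotientGroup.induction_on with
    | H h => exact (hmem h).1 hq
  · obtain ⟨q, hq⟩ := q
    induction q using QuotientGroup.induction_on with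
    | H h =>
      refine QuotientGroup.eq.2 ?_
      simp
  · rintro ⟨q, hq⟩ ⟨q', hq'⟩ h
    induction q using QuotientGroup.induction_on with
    | H a =>
    induction q' using QuotientGroup.induction_on with
    | H b =>
      have h1 : ((g * (a : G) : G) : G ⧸ A) = (g * (b : G) : G) := congrArg (fun z => z.1.1) h
      rw [QuotientGroup.eq] at h1
      refine Subtype.ext (QuotientGroup.eq.2 ?_)
      rw [Subgroup.mem_subgroupOf]
      simpa [mul_assoc] using h1
  · rintro ⟨⟨y, hy⟩, hyg⟩
    induction y using QuotientGroup.induction_on with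
    | H y =>
      have hyH : g⁻¹ * y ∈ H := QuotientGroup.eq.1 hyg.symm
      have hgy : g * (g⁻¹ * y) = y := by group
      refine ⟨⟨((⟨_, hyH⟩ : H) : H ⧸ A.subgroupOf H), (hmem _).2 ?_⟩, ?_⟩
      · simpa only [hgy] using hy
      · refine Subtype.ext (Subtype.ext ?_)
        exact congrArg (QuotientGroup.mk (s := A)) hgy

variable [Finite G]

theorem mark_eq_sum_fixedPoints (hAH : A ≤ H) (U : Subgroup G)
    [Fintype (subgroupFixedPoints (G ⧸ H) U)] :
    mark (G ⧸ A) U = ∑ q : subgroupFixedPoints (G ⧸ H) U,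
      mark (H ⧸ A.subgroupOf H) ((MulAut.conj (q : G ⧸ H).out⁻¹ • U).subgroupOf H) := by
  have hmaps : ∀ y ∈ subgroupFixedPoints (G ⧸ A) U,
      Subgroup.quotientMapOfLE hAH y ∈ subgroupFixedPoints (G ⧸ H) U := by
    intro y hy
    induction y using QuotientGroup.induction_on with
    | H y =>
      exact mk_mem_fixedPoints_iff.2 fun u hu => hAH (mk_mem_fixedPoints_iff.1 hy u hu)
  rw [mark, ← Nat.card_congr (Equiv.sigmaFiberEquiv fun y : subgroupFixedPoints (G ⧸ A) U =>
    (⟨_, hmaps y y.2⟩ : subgroupFixedPoints (G ⧸ H) U)), Nat.card_sigma]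
  refine Finset.sum_congr rfl fun q _ => ?_
  have hq : ((q : G ⧸ H).out : G ⧸ H) = q := QuotientGroup.out_eq' _
  rw [← card_fixedPoints_fiber hAH U _ (by rw [hq]; exact q.2)]
  refine Nat.card_congr (Equiv.subtypeEquivRight fun y => ?_)
  rw [hq, Subtype.ext_iff]

theorem ind_apply_of_mem_markSpan {R : Type*} [CommRing R]
    (ind : (Subgroup H → R) →ₗ[R] (Subgroup G → R))
    (hind : ∀ A : Subgroup G, A ≤ H →
      ind (fun V : Subgroup H => (mark (H ⧸ A.subgroupOf H) V : R)) =
        fun U : Subgroup G => (mark (G ⧸ A) U : R))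
    {f : Subgroup H → R} (hf : f ∈ markSpan R H) (U : Subgroup G)
    [Fintype (subgroupFixedPoints (G ⧸ H) U)] :
    ind f U = ∑ q : subgroupFixedPoints (G ⧸ H) U,
      f ((MulAut.conj (q : G ⧸ H).out⁻¹ • U).subgroupOf H) := by
  induction hf using Submodule.span_induction with
  | mem f hf =>
    obtain ⟨B, rfl⟩ := hf
    have hB : (B.map H.subtype).subgroupOf H = B := by
      exact Subgroup.comap_map_eq_self_of_injective H.subtype_injective B
    have hle : B.map H.subtype ≤ H := Subgroup.map_subtype_le B
    have h := congrFun (hind _ hle) U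
    rw [mark_eq_sum_fixedPoints hle U, hB] at h
    simpa using h
  | zero => simp
  | add f g _ _ hf hg => simp [hf, hg, Finset.sum_add_distrib]
  | smul a f _ hf => simp [hf, Finset.mul_sum]

end Induction

/-- Let `R` be a commutative ring in which every prime divisor of `|G|` other than `p` is
invertible, `J` a `p`-perfect subgroup of `G` and `J ≤ H ≤ G`. Identifying Burnside
algebras with their rings of mark functions, the mark of `f_J` at `U` is the indicator
that `O^p(U)` is conjugate to `J` (Yoshida), the mark of `[G/A]` at `U` is the number of
`U`-fixed points of `G/A`, and induction `Ind_H^G` is any `R`-linear map on mark functions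
sending the marks of `[H/A]` to the marks of `[G/A]` for all `A ≤ H`. Then
`Ind_H^G([H/J] · f_J^H) = [G/J] · f_J^G`. -/
theorem ind_transitive_mul_idempotent (G : Type*) [Group G] [Fintype G] (p : ℕ)
    (hp : p.Prime) (R : Type*) [CommRing R]
    (hinv : ∀ q : ℕ, q.Prime → q ∣ Fintype.card G → q ≠ p → IsUnit (q : R))
    (H J : Subgroup G) (hJH : J ≤ H) (hperf : pResidualSub p J = J)
    (fJG : Subgroup G → R) (fJH : Subgroup ↥H → R)
    (hfJG : ∀ U : Subgroup G,
      fJG U = if ∃ g : G, MulAut.conj g • pResidualSub p U = J then 1 else 0)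
    (hfJH : ∀ V : Subgroup ↥H,
      fJH V = if ∃ h : ↥H, MulAut.conj h • pResidualSub p V = J.subgroupOf H then 1 else 0)
    (ind : (Subgroup ↥H → R) →ₗ[R] (Subgroup G → R))
    (hind : ∀ A : Subgroup G, A ≤ H →
      ind (fun V : Subgroup ↥H =>
          (Nat.card (MulAction.fixedPoints V (↥H ⧸ A.subgroupOf H)) : R)) =
        fun U : Subgroup G => (Nat.card (MulAction.fixedPoints U (G ⧸ A)) : R)) :
    ind (fun V : Subgroup ↥H =>
        (Nat.card (MulAction.fixedPoints V (↥H ⧸ J.subgroupOf H)) : R) * fJH V) =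
      fun U : Subgroup G =>
        (Nat.card (MulAction.fixedPoints U (G ⧸ J)) : R) * fJG U := by
  have : Fact p.Prime := ⟨hp⟩
  have hJ : pResidual p J = ⊤ := (pResidualSub_eq_self_iff J).1 hperf
  let e := (Subgroup.subgroupOfEquivOfLe hJH).symm
  have hJH' : pResidual p (J.subgroupOf H) = ⊤ :=
    pResidual_eq_top_of_surjective e.toMonoidHom e.surjective hJ
  have hcardJ : Nat.card (J.subgroupOf H) = Nat.card J := Nat.card_congr e.symm.toEquiv
  have hmem := mark_mul_indicator_card_mem_markAlgebra (R := R) (K := H) (p := p)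
    (fun q hq hqH => hinv q hq
      (hqH.trans (Nat.card_eq_fintype_card (α := G) ▸ Subgroup.card_subgroup_dvd_card H))) hJH'
  have hleft : (fun V : Subgroup ↥H =>
      (Nat.card (MulAction.fixedPoints V (↥H ⧸ J.subgroupOf H)) : R) * fJH V) =
      fun V : Subgroup H => (mark (H ⧸ J.subgroupOf H) V : R) *
        if Nat.card V = Nat.card (J.subgroupOf H) then 1 else 0 := by
    funext V
    rw [hfJH, ← mark_mul_indicator_pResidualSub hJH' V]
    congr!
  funext U
  let : Fintype (subgroupFixedPoints (G ⧸ H) U) := Fintype.ofFinite _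
  have hright : (Nat.card (MulAction.fixedPoints U (G ⧸ J)) : R) * fJG U =
      (mark (G ⧸ J) U : R) * if Nat.card U = Nat.card J then 1 else 0 := by
    rw [hfJG, ← mark_mul_indicator_pResidualSub hJ U]
    congr!
  rw [hleft, hright, ind_apply_of_mem_markSpan ind hind hmem U, mark_eq_sum_fixedPoints hJH U,
    Nat.cast_sum, Finset.sum_mul]
  refine Finset.sum_congr rfl fun q _ => ?_
  have hle : MulAut.conj (q : G ⧸ H).out⁻¹ • U ≤ H := by
    have hq : ((q : G ⧸ H).out : G ⧸ H) = q := QuotientGroup.out_eq' _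
    rintro _ ⟨u, hu, rfl⟩
    simpa using mk_mem_fixedPoints_iff.1 (hq.symm ▸ q.2) u hu
  rw [Nat.card_congr (Subgroup.subgroupOfEquivOfLe hle).toEquiv, card_conj_smul, hcardJ]
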